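/- Let q ≥ 2 and k, ℓ ≥ 2 be integers. Let x ∈ Z_q^n and let i be an integer with 1 ≤ i ≤ n−2k−ℓ+2 such that x[i, i+2k+ℓ−2] = (x_i, ..., x_{i+2k+ℓ−2}) is k-periodic. Let x' ∈ Z_q^{n−k} be obtained from x by deleting the symbols in positions i through i+k−1. Then Δ_k(R_ℓ(x')) equals the word obtained from Δ_k(R_ℓ(x)) by deleting the entries in positions i+k+ℓ−1 through i+2k+ℓ−2 (these entries form a factor 0^k); consequently N_{k,ℓ}(x') = N_{k,ℓ}(x). -/

import Mathlib

/-- The composition of a word over `Fin q`, as an element of `ℤ^q`: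
it counts, for each letter `a`, the number of occurrences of `a`. -/
def comp {q : ℕ} (w : List (Fin q)) : Fin q → ℤ := fun a => (w.count a : ℤ)

/-- The `ℓ`-read vector of a word over `Fin q`: a word of length `n + ℓ - 1`
over `ℤ^q` whose `p`-th entry is the composition of the window of the last `ℓ`
symbols ending at position `p` (symbols outside the word are omitted). -/
def readVec {q : ℕ} (ℓ : ℕ) (x : List (Fin q)) : List (Fin q → ℤ) :=
  (List.range (x.length + ℓ - 1)).map fun p => comp ((x.take (p + 1)).drop (p + 1 - ℓ))

/-- The `k`-step derivative of a word over an abelian group, with the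
convention that entries at nonpositive positions are `0`. -/
def kderiv {G : Type*} [AddCommGroup G] (k : ℕ) (y : List G) : List G :=
  (List.range y.length).map fun i => y.getD i 0 - if k ≤ i then y.getD (i - k) 0 else 0

/-- The lengths `(m_0, m_1, ..., m_s)` of the maximal (possibly empty) runs of
zeros in `y = 0^{m_0} y_1 0^{m_1} ⋯ y_s 0^{m_s}` with `y_1, ..., y_s ≠ 0`. -/
def zeroRuns {G : Type*} [Zero G] [DecidableEq G] (y : List G) : List ℕ :=
  (y.splitOnP fun a => decide (a ≠ 0)).map List.length

/-- `σ_k(y) = (⌊m_0/k⌋, ⌊m_1/k⌋, ..., ⌊m_s/k⌋)`. -/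
def sigmak {G : Type*} [Zero G] [DecidableEq G] (k : ℕ) (y : List G) : List ℕ :=
  (zeroRuns y).map fun m => m / k

/-- Interleave zero runs of the given lengths with the given (nonzero) letters:
`assemble (m_0 :: ... :: m_s) (y_1 :: ... :: y_s) = 0^{m_0} y_1 0^{m_1} ⋯ y_s 0^{m_s}`. -/
def assemble {G : Type*} [Zero G] : List ℕ → List G → List G
  | [], _ => []
  | m :: _, [] => List.replicate m (0 : G)
  | m :: ms, a :: as => List.replicate m (0 : G) ++ a :: assemble ms as

/-- `μ_k(y) = 0^{m_0 % k} y_1 0^{m_1 % k} ⋯ y_s 0^{m_s % k}`. -/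
def muk {G : Type*} [Zero G] [DecidableEq G] (k : ℕ) (y : List G) : List G :=
  assemble ((zeroRuns y).map fun m => m % k) (y.filter fun a => decide (a ≠ 0))

/-- The nucleus `N_{k,ℓ}(x) = μ_k(Δ_k(R_ℓ(x)))` of a word over `Fin q`. -/
def nucleus {q : ℕ} (k ℓ : ℕ) (x : List (Fin q)) : List (Fin q → ℤ) :=
  muk k (kderiv k (readVec ℓ x))

/-- A single tandem duplication of length `k`: `u v w ↦ u v v w` with `|v| = k`. -/
def TD {α : Type*} (k : ℕ) (y z : List α) : Prop :=
  ∃ u v w : List α, v.length = k ∧ y = u ++ (v ++ w) ∧ z = u ++ (v ++ (v ++ w))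

/-- `TDt k t y z` holds iff `z` arises from `y` by a sequence of exactly `t`
tandem duplications of length `k`, i.e. `y ⟹_k^t z`. -/
def TDt {α : Type*} (k : ℕ) : ℕ → List α → List α → Prop
  | 0 => fun y z => y = z
  | t + 1 => fun y z => ∃ w, TDt k t y w ∧ TD k w z

/-- The ball `B_{k,t}(y)`: all words obtained from `y` by at most `t` tandem
duplications of length `k`. -/
def Ball {α : Type*} (k t : ℕ) (y : List α) : Set (List α) :=
  {z | ∃ j ≤ t, TDt k j y z}

/-- `x` is `(k,ℓ)`-fine: it contains no `k`-periodic factor of length `2k+ℓ-1`. -/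
def Fine {q : ℕ} (k ℓ : ℕ) (x : List (Fin q)) : Prop :=
  ∀ i : ℕ, 1 ≤ i → i + 2 * k + ℓ - 2 ≤ x.length →
    (x.drop (i - 1)).take (k + ℓ - 1) ≠ (x.drop (i - 1 + k)).take (k + ℓ - 1)

/-- `y` contains the factor `0^k` (a run of `k` consecutive zeros). -/
def HasZeroBlock {G : Type*} [Zero G] (k : ℕ) (y : List G) : Prop :=
  ∃ j, j + k ≤ y.length ∧ (y.drop j).take k = List.replicate k (0 : G)

/-- `λ_{m,q}`: the largest real root of `x^{m+2} - q·x^{m+1} + q - 1`. -/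
noncomputable def lambdaRoot (m q : ℕ) : ℝ :=
  sSup {x : ℝ | x ^ (m + 2) - (q : ℝ) * x ^ (m + 1) + (q : ℝ) - 1 = 0}

/-- The dot product `a ⊙ b = Σ_{i=1}^{min(|a|,|b|)} a_i · b_i`. -/
def dot {G : Type*} [AddCommMonoid G] (a : List ℕ) (b : List G) : G :=
  (List.zipWith (fun m g => m • g) a b).sum

/-- Prepending a zero lengthens the first zero run; prepending a nonzero letter opens a new one. -/
theorem zeroRuns_cons {G : Type*} [Zero G] [DecidableEq G] (a : G) (y : List G) :
    zeroRuns (a :: y) =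
      if a = 0 then (zeroRuns y).modifyHead (· + 1) else 0 :: zeroRuns y := by
  unfold zeroRuns
  rw [List.splitOnP_cons_eq_if_modifyHead]
  by_cases h : a = 0
  · simp only [h, ne_eq, not_true_eq_false, decide_false, Bool.false_eq_true, if_false, if_true]
    cases (List.splitOnP (fun a : G => decide (¬a = 0)) y) <;> simp
  · simp [h]

theorem zeroRuns_replicate_append {G : Type*} [Zero G] [DecidableEq G] (k : ℕ) (w : List G) :
    zeroRuns (List.replicate k 0 ++ w) = (zeroRuns w).modifyHead (· + k) := by
  induction k with
  | zero => cases h : zeroRuns w <;> simp [h]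
  | succ k ih =>
    rw [List.replicate_succ, List.cons_append, zeroRuns_cons, if_pos rfl, ih]
    cases zeroRuns w <;> simp [add_assoc]

theorem map_mod_modifyHead_succ (k : ℕ) (l : List ℕ) :
    (l.modifyHead (· + 1)).map (· % k) =
      (l.map (· % k)).modifyHead fun m => (m + 1) % k := by
  cases l <;> simp

theorem map_mod_zeroRuns_insert {G : Type*} [Zero G] [DecidableEq G] (k : ℕ) (u w : List G) :
    (zeroRuns (u ++ (List.replicate k 0 ++ w))).map (· % k) =
      (zeroRuns (u ++ w)).map (· % k) := by
  induction u with
  | nil =>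
    rw [List.nil_append, zeroRuns_replicate_append]
    cases h : zeroRuns w <;> simp [h]
  | cons a u ih =>
    rw [List.cons_append, List.cons_append, zeroRuns_cons, zeroRuns_cons]
    split_ifs
    · rw [map_mod_modifyHead_succ, map_mod_modifyHead_succ, ih]
    · rw [List.map_cons, List.map_cons, ih]

/-- Inserting a factor `0^k` does not change `μ_k`. -/
theorem muk_insert_replicate {G : Type*} [Zero G] [DecidableEq G] (k : ℕ) (u w : List G) :
    muk k (u ++ (List.replicate k 0 ++ w)) = muk k (u ++ w) := by
  unfold muk
  rw [map_mod_zeroRuns_insert]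
  simp

theorem length_readVec {q : ℕ} (ℓ : ℕ) (x : List (Fin q)) :
    (readVec ℓ x).length = x.length + ℓ - 1 := by
  simp [readVec]

theorem length_kderiv {G : Type*} [AddCommGroup G] (k : ℕ) (y : List G) :
    (kderiv k y).length = y.length := by
  simp [kderiv]

theorem getD_readVec {q : ℕ} (ℓ : ℕ) (x : List (Fin q)) {p : ℕ} (hp : p < x.length + ℓ - 1) :
    (readVec ℓ x).getD p 0 = comp ((x.take (p + 1)).drop (p + 1 - ℓ)) := by
  simp [readVec, hp]

theorem getElem_kderiv {G : Type*} [AddCommGroup G] (k : ℕ) (y : List G) (p : ℕ)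
    (hp : p < (kderiv k y).length) :
    (kderiv k y)[p] = y.getD p 0 - if k ≤ p then y.getD (p - k) 0 else 0 := by
  simp [kderiv]

/-- Two reads agree when their windows, one shifted by `s`, agree letter by letter. -/
theorem getD_readVec_shift {q : ℕ} {ℓ s p : ℕ} {x y : List (Fin q)}
    (hy : p < y.length + ℓ - 1) (hx : p + s < x.length + ℓ - 1) (hs : s = 0 ∨ ℓ ≤ p + 1)
    (h : ∀ j, p + 1 - ℓ ≤ j → j ≤ p → y[j]? = x[j + s]?) :
    (readVec ℓ y).getD p 0 = (readVec ℓ x).getD (p + s) 0 := by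
  rw [getD_readVec ℓ y hy, getD_readVec ℓ x hx]
  congr 1
  apply List.ext_getElem?
  intro j
  rw [List.getElem?_drop, List.getElem?_drop, List.getElem?_take, List.getElem?_take]
  by_cases hj : p + 1 - ℓ + j < p + 1
  · rw [if_pos hj, if_pos (by omega), h _ (by omega) (by omega)]
    congr 1
    omega
  · rw [if_neg hj, if_neg (by omega)]


/-- if `x[i, i+2k+ℓ−2]` is `k`-periodic and `x'` is obtained from
`x` by deleting positions `i` through `i+k−1`, then `Δ_k(R_ℓ(x'))` is obtained
from `Δ_k(R_ℓ(x))` by deleting the entries at positions `i+k+ℓ−1` through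
`i+2k+ℓ−2` (which form a factor `0^k`); consequently `N_{k,ℓ}(x') = N_{k,ℓ}(x)`. -/
theorem stmt_9 (q k ℓ : ℕ) (hq : 2 ≤ q) (hk : 2 ≤ k) (hl : 2 ≤ ℓ)
    (x : List (Fin q)) (i : ℕ) (hi : 1 ≤ i) (hin : i + 2 * k + ℓ - 2 ≤ x.length)
    (hper : (x.drop (i - 1)).take (k + ℓ - 1) = (x.drop (i - 1 + k)).take (k + ℓ - 1)) :
    ((kderiv k (readVec ℓ x)).drop (i + k + ℓ - 2)).take k =
        List.replicate k (0 : Fin q → ℤ) ∧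
      kderiv k (readVec ℓ (x.take (i - 1) ++ x.drop (i - 1 + k))) =
        (kderiv k (readVec ℓ x)).take (i + k + ℓ - 2) ++
          (kderiv k (readVec ℓ x)).drop (i + 2 * k + ℓ - 2) ∧
      nucleus k ℓ (x.take (i - 1) ++ x.drop (i - 1 + k)) = nucleus k ℓ x := by
  obtain ⟨a, rfl⟩ : ∃ a, i = a + 1 := ⟨i - 1, by omega⟩
  rw [Nat.add_sub_cancel] at hper ⊢
  have period : ∀ j, a ≤ j → j < a + k + ℓ - 1 → x[j]? = x[j + k]? := by
    intro j h1 h2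
    have h := congrArg (fun l => l[j - a]?) hper
    simp only [List.getElem?_take, List.getElem?_drop] at h
    rw [if_pos (by omega), if_pos (by omega)] at h
    rwa [show a + (j - a) = j by omega, show a + k + (j - a) = j + k by omega] at h
  set x' := x.take a ++ x.drop (a + k) with hx'
  have length_x' : x'.length = x.length - k := by
    simp only [hx', List.length_append, List.length_take, List.length_drop]
    omega
  have right : ∀ j, a ≤ j → x'[j]? = x[j + k]? := by
    intro j hj
    rw [hx', List.getElem?_append_right (by simp; omega), List.getElem?_drop,
      List.length_take, min_eq_left (by omega)]
    congr 1
    omega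
  have left : ∀ j, j < a + k + ℓ - 1 → x'[j]? = x[j]? := by
    intro j hj
    by_cases hja : j < a
    · rw [hx', List.getElem?_append_left (by simp; omega), List.getElem?_take, if_pos hja]
    · rw [right j (by omega), period j (by omega) hj]
  have read_period : ∀ p, a + ℓ - 1 ≤ p → p < a + k + ℓ - 1 →
      (readVec ℓ x).getD p 0 = (readVec ℓ x).getD (p + k) 0 := fun p h1 h2 =>
    getD_readVec_shift (by omega) (by omega) (by omega)
      fun j h3 h4 => period j (by omega) (by omega)
  have read_left : ∀ p, p < a + k + ℓ - 1 →
      (readVec ℓ x').getD p 0 = (readVec ℓ x).getD p 0 := fun p h1 =>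
    getD_readVec_shift (s := 0) (by omega) (by omega) (by omega)
      fun j h3 h4 => left j (by omega)
  have read_right : ∀ p, a + ℓ - 1 ≤ p → p < x.length - k + ℓ - 1 →
      (readVec ℓ x').getD p 0 = (readVec ℓ x).getD (p + k) 0 := fun p h1 h2 =>
    getD_readVec_shift (by omega) (by omega) (by omega)
      fun j h3 h4 => right j (by omega)
  have zeros : ((kderiv k (readVec ℓ x)).drop (a + 1 + k + ℓ - 2)).take k =
      List.replicate k (0 : Fin q → ℤ) := by
    apply List.ext_getElem
    · simp only [List.length_take, List.length_drop, length_kderiv, length_readVec,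
        List.length_replicate]
      omega
    · intro p h1 h2
      have hp : p < k := by rwa [List.length_replicate] at h2
      rw [List.getElem_take, List.getElem_drop, getElem_kderiv, if_pos (by omega),
        List.getElem_replicate, read_period (a + 1 + k + ℓ - 2 + p - k) (by omega) (by omega),
        Nat.sub_add_cancel (by omega),
        sub_self]
  have deletion : kderiv k (readVec ℓ x') =
      (kderiv k (readVec ℓ x)).take (a + 1 + k + ℓ - 2) ++
        (kderiv k (readVec ℓ x)).drop (a + 1 + 2 * k + ℓ - 2) := by
    apply List.ext_getElem
    · simp only [List.length_append, List.length_take, List.length_drop, length_kderiv,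
        length_readVec]
      omega
    · intro p h1 h2
      rw [length_kderiv, length_readVec] at h1
      rw [getElem_kderiv]
      by_cases hp : p < a + k + ℓ - 1
      · rw [List.getElem_append_left (by
            simp only [List.length_take, length_kderiv, length_readVec]; omega),
          List.getElem_take, getElem_kderiv, read_left p hp, read_left (p - k) (by omega)]
      · have hlen : ((kderiv k (readVec ℓ x)).take (a + 1 + k + ℓ - 2)).length =
            a + k + ℓ - 1 := by
          simp only [List.length_take, length_kderiv, length_readVec]
          omega
        rw [List.getElem_append_right (by omega), List.getElem_drop, getElem_kderiv,
          read_right p (by omega) (by omega), read_right (p - k) (by omega) (by omega),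
          if_pos (by omega), if_pos (by omega), hlen,
          show a + 1 + 2 * k + ℓ - 2 + (p - (a + k + ℓ - 1)) = p + k by omega,
          Nat.add_sub_cancel, Nat.sub_add_cancel (by omega)]
  refine ⟨zeros, deletion, ?_⟩
  rw [nucleus, nucleus, deletion, ← muk_insert_replicate, ← zeros,
    show a + 1 + 2 * k + ℓ - 2 = a + 1 + k + ℓ - 2 + k by omega, ← List.drop_drop,
    List.take_append_drop, List.take_append_drop]
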